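/- Let 𝒯 be a finite undirected tree, w : V(𝒯) → ℝ≥0 a weight function, m = w(𝒯), α ∈ [1/3, 1/2], and let c be an α-centroid of (𝒯,w). Then OPT(𝒯,w) ≥ (2−3α)·m + (3α−1)·w(c) + Σ_{ℋ ∈ 𝒞(𝒯−c)} OPT(ℋ,w), where the sum ranges over the connected components of 𝒯 − c. -/

import Mathlib

open Filter Topology

universe u

variable {V : Type u}

/-- Rooted trees with vertices labelled by elements of `V`. -/
inductive RTree (V : Type u) : Type u where
  | node : V → List (RTree V) → RTree V

namespace RTree

/-- The root of a rooted tree. -/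
def root : RTree V → V
  | node r _ => r

/-- The subtrees rooted at the children of the root. -/
def children : RTree V → List (RTree V)
  | node _ ts => ts

/-- The list of pairs `(v, path from the root to v)` over all vertices `v` of the tree. -/
def pathsFrom : RTree V → List (V × List V)
  | node r ts =>
      (r, [r]) ::
        (ts.attach.map fun t => (t.1.pathsFrom.map fun p => (p.1, r :: p.2))).flatten
  decreasing_by
    simp only [RTree.node.sizeOf_spec]
    have := List.sizeOf_lt_of_mem t.2
    omega

/-- The vertex set of a rooted tree. -/
def vertSet (T : RTree V) : Set V := {v | ∃ p ∈ T.pathsFrom, p.1 = v}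

/-- `Path_T(v)`: the set of vertices on the path in `T` from the root to `v`
(including both endpoints). -/
def pathSet (T : RTree V) (v : V) : Set V := {x | ∃ p ∈ T.pathsFrom, p.1 = v ∧ x ∈ p.2}

/-- The depth of a vertex `v` in `T`; the root has depth 1. -/
noncomputable def depth (T : RTree V) (v : V) : ℕ := (T.pathSet v).ncard

/-- All subtrees of a rooted tree (including the tree itself). -/
def allSubtrees : RTree V → List (RTree V)
  | node r ts => node r ts :: (ts.attach.map fun t => t.1.allSubtrees).flatten
  decreasing_by
    simp only [RTree.node.sizeOf_spec]
    have := List.sizeOf_lt_of_mem t.2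
    omega

/-- Two rooted trees are equivalent (represent the same search tree) if they have
the same root-to-vertex paths. -/
def Equiv (T₁ T₂ : RTree V) : Prop := ∀ v, T₁.pathSet v = T₂.pathSet v

end RTree

/-- `x` and `y` are joined by a walk of `G` staying inside `s`. -/
def ReachIn (G : SimpleGraph V) (s : Set V) (x y : V) : Prop :=
  ∃ p : G.Walk x y, ∀ v ∈ p.support, v ∈ s

/-- The connected component of `x` in the subgraph of `G` induced by `s`. -/
def compIn (G : SimpleGraph V) (s : Set V) (x : V) : Set V := {y | ReachIn G s x y}

/-- The set of connected components of the subgraph of `G` induced by `s`. -/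
def comps (G : SimpleGraph V) (s : Set V) : Set (Set V) := {c | ∃ x ∈ s, c = compIn G s x}

/-- `s` induces a (nonempty) connected subgraph of `G`. -/
def ConnIn (G : SimpleGraph V) (s : Set V) : Prop :=
  s.Nonempty ∧ ∀ x ∈ s, ∀ y ∈ s, ReachIn G s x y

/-- The total weight of a set of vertices. -/
noncomputable def wsum (w : V → ℝ) (s : Set V) : ℝ := ∑ᶠ x ∈ s, w x

/-- `IsSearchTree G s T`: `T` is a search tree on the subgraph of `G` induced by `s`.
Its root `r` is a vertex of `s`, its vertex set is `s`, and the subtrees rooted at the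
children of `r` are search trees on the connected components of the induced subgraph
on `s \ {r}` (one subtree for each component). -/
inductive IsSearchTree (G : SimpleGraph V) : Set V → RTree V → Prop where
  | node {s : Set V} {r : V} {ts : List (RTree V)} :
      r ∈ s →
      (RTree.node r ts).vertSet = s →
      (∀ t ∈ ts, IsSearchTree G (compIn G (s \ {r}) t.root) t) →
      ts.Pairwise (fun t₁ t₂ => compIn G (s \ {r}) t₁.root ≠ compIn G (s \ {r}) t₂.root) →
      IsSearchTree G s (RTree.node r ts)

/-- The cost of a search tree: `∑_x w(x) · depth(x)`, the root having depth 1. -/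
noncomputable def cost (w : V → ℝ) (T : RTree V) : ℝ :=
  ∑ᶠ v ∈ T.vertSet, w v * (T.depth v : ℝ)

/-- The optimum cost of a search tree on the subgraph of `G` induced by `s`. -/
noncomputable def OPT (G : SimpleGraph V) (w : V → ℝ) (s : Set V) : ℝ :=
  sInf (cost w '' {T | IsSearchTree G s T})

/-- `v` is an `α`-centroid of the subgraph of `G` induced by `s` (with weights `w`):
every connected component of the induced subgraph on `s \ {v}` has weight at most
`α` times the weight of `s`. -/
def IsAlphaCentroid (G : SimpleGraph V) (w : V → ℝ) (α : ℝ) (s : Set V) (v : V) : Prop :=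
  v ∈ s ∧ ∀ x ∈ s \ {v}, wsum w (compIn G (s \ {v}) x) ≤ α * wsum w s

/-- `v` is a centroid of the subgraph of `G` induced by `s` (with weights `w`). -/
def IsCentroid (G : SimpleGraph V) (w : V → ℝ) (s : Set V) (v : V) : Prop :=
  v ∈ s ∧ ∀ x ∈ s \ {v}, wsum w (compIn G (s \ {v}) x) ≤ wsum w s / 2

/-- `T` is an `α`-centroid tree on the subgraph of `G` induced by `s`. -/
def IsAlphaCentroidTree (G : SimpleGraph V) (w : V → ℝ) (α : ℝ) (s : Set V) (T : RTree V) :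
    Prop :=
  IsSearchTree G s T ∧ ∀ t ∈ T.allSubtrees, IsAlphaCentroid G w α t.vertSet t.root

/-- `T` is a centroid tree on the subgraph of `G` induced by `s`. -/
def IsCentroidTree (G : SimpleGraph V) (w : V → ℝ) (s : Set V) (T : RTree V) : Prop :=
  IsSearchTree G s T ∧ ∀ t ∈ T.allSubtrees, IsCentroid G w t.vertSet t.root

/-- `cent(𝒯,w)`: the maximum cost of a centroid tree. -/
noncomputable def centCost (G : SimpleGraph V) (w : V → ℝ) (s : Set V) : ℝ :=
  sSup (cost w '' {T | IsCentroidTree G w s T})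

/-- `centᵅ(𝒯,w)`: the maximum cost of an `α`-centroid tree (`0` if none exists, since
`sSup ∅ = 0` in `ℝ`). -/
noncomputable def centCostA (G : SimpleGraph V) (w : V → ℝ) (α : ℝ) (s : Set V) : ℝ :=
  sSup (cost w '' {T | IsAlphaCentroidTree G w α s T})

/-- `b` is a child of `a` in the rooted tree `T`. -/
def ChildRel (T : RTree V) (a b : V) : Prop :=
  ∃ t ∈ T.allSubtrees, t.root = a ∧ ∃ t' ∈ t.children, t'.root = b

namespace RTree

theorem mem_pathsFrom_node {r : V} {ts : List (RTree V)} {p : V × List V} :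
    p ∈ (node r ts).pathsFrom ↔
      p = (r, [r]) ∨ ∃ t ∈ ts, ∃ q ∈ t.pathsFrom, p = (q.1, r :: q.2) := by
  rw [pathsFrom]
  simp only [List.mem_cons, List.mem_flatten, List.mem_map, List.mem_attach, true_and,
    Subtype.exists]
  constructor
  · rintro (h | ⟨_, ⟨t, ht, rfl⟩, hp⟩)
    · exact Or.inl h
    · obtain ⟨q, hq, rfl⟩ := List.mem_map.1 hp
      exact Or.inr ⟨t, ht, q, hq, rfl⟩
  · rintro (h | ⟨t, ht, q, hq, rfl⟩)
    · exact Or.inl h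
    · exact Or.inr ⟨_, ⟨t, ht, rfl⟩, List.mem_map.2 ⟨q, hq, rfl⟩⟩

theorem vertSet_node (r : V) (ts : List (RTree V)) :
    (node r ts).vertSet = insert r (⋃ t ∈ ts, t.vertSet) := by
  ext v
  simp only [vertSet, mem_pathsFrom_node, Set.mem_ofPred_eq, Set.mem_insert_iff, Set.mem_iUnion,
    exists_prop]
  constructor
  · rintro ⟨p, rfl | ⟨t, ht, q, hq, rfl⟩, rfl⟩
    · exact Or.inl rfl
    · exact Or.inr ⟨t, ht, q, hq, rfl⟩
  · rintro (rfl | ⟨t, ht, q, hq, rfl⟩)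
    · exact ⟨_, Or.inl rfl, rfl⟩
    · exact ⟨_, Or.inr ⟨t, ht, q, hq, rfl⟩, rfl⟩

theorem vertSet_subset_node {r : V} {ts : List (RTree V)} {t : RTree V} (ht : t ∈ ts) :
    t.vertSet ⊆ (node r ts).vertSet := by
  rw [vertSet_node]
  exact fun v hv => Or.inr (Set.mem_biUnion ht hv)

end RTree

section Reach

variable {G : SimpleGraph V} {s t : Set V} {x y z : V}

theorem ReachIn.left_mem (h : ReachIn G s x y) : x ∈ s := by
  obtain ⟨p, hp⟩ := h
  exact hp _ p.start_mem_support

theorem ReachIn.right_mem (h : ReachIn G s x y) : y ∈ s := by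
  obtain ⟨p, hp⟩ := h
  exact hp _ p.end_mem_support

theorem ReachIn.refl (h : x ∈ s) : ReachIn G s x x :=
  ⟨SimpleGraph.Walk.nil, by simpa using h⟩

theorem ReachIn.symm (h : ReachIn G s x y) : ReachIn G s y x := by
  obtain ⟨p, hp⟩ := h
  exact ⟨p.reverse, fun v hv => hp v (by simpa using hv)⟩

theorem ReachIn.trans (h : ReachIn G s x y) (h' : ReachIn G s y z) : ReachIn G s x z := by
  obtain ⟨p, hp⟩ := h
  obtain ⟨q, hq⟩ := h'
  refine ⟨p.append q, fun v hv => ?_⟩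
  rcases (SimpleGraph.Walk.mem_support_append_iff p q).1 hv with h | h
  exacts [hp v h, hq v h]

theorem ReachIn.mono (hst : s ⊆ t) (h : ReachIn G s x y) : ReachIn G t x y := by
  obtain ⟨p, hp⟩ := h
  exact ⟨p, fun v hv => hst (hp v hv)⟩

theorem ReachIn.of_adj (hx : x ∈ s) (hy : y ∈ s) (h : G.Adj x y) : ReachIn G s x y :=
  ⟨h.toWalk, by simp [hx, hy]⟩

/-- A walk in `s` starting in a set closed under adjacency in `s` stays in that set. -/
theorem ReachIn.inter_of_closed {A : Set V} (h : ReachIn G s x y) (hx : x ∈ A)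
    (hA : ∀ a ∈ A, ∀ b ∈ s, G.Adj a b → b ∈ A) : ReachIn G (s ∩ A) x y := by
  obtain ⟨p, hp⟩ := h
  induction p with
  | nil => exact .refl ⟨hp _ (by simp), hx⟩
  | @cons u v _ huv p ih =>
    have hv : v ∈ s := hp v (by simp)
    have hvA := hA _ hx _ hv huv
    have hu : u ∈ s ∩ A := ⟨hp _ (by simp), hx⟩
    exact (ReachIn.of_adj hu ⟨hv, hvA⟩ huv).trans (ih hvA fun a ha => hp a (by simp [ha]))

theorem mem_compIn_self (h : x ∈ s) : x ∈ compIn G s x := ReachIn.refl h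

theorem compIn_subset : compIn G s x ⊆ s := fun _ h => ReachIn.right_mem h

theorem compIn_mono (h : s ⊆ t) : compIn G s x ⊆ compIn G t x := fun _ => ReachIn.mono h

theorem compIn_eq_of_mem (h : y ∈ compIn G s x) : compIn G s y = compIn G s x :=
  Set.Subset.antisymm (fun _ hz => ReachIn.trans h hz) fun _ hz => (ReachIn.symm h).trans hz

theorem mem_compIn_of_adj (hy : y ∈ compIn G s x) (hz : z ∈ s) (h : G.Adj y z) :
    z ∈ compIn G s x :=
  ReachIn.trans hy (.of_adj (compIn_subset hy) hz h)

theorem compIn_compIn (h : x ∈ s) : compIn G (compIn G s x) x = compIn G s x := by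
  refine compIn_subset.antisymm fun y hy => ?_
  have := ReachIn.inter_of_closed hy (mem_compIn_self h) fun a ha b hb => mem_compIn_of_adj ha hb
  exact this.mono Set.inter_subset_right

theorem comps_eq_singleton (hx : x ∈ s) (h : compIn G s x = s) : comps G s = {s} := by
  ext K
  constructor
  · rintro ⟨y, hy, rfl⟩
    exact (compIn_eq_of_mem (x := x) (by rwa [h])).trans h
  · rintro rfl
    exact ⟨x, hx, h.symm⟩

theorem compIn_union_left {A B : Set V} (hAB : ∀ a ∈ A, ∀ b ∈ B, ¬ G.Adj a b) (hx : x ∈ A) :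
    compIn G (A ∪ B) x = compIn G A x := by
  refine Set.Subset.antisymm (fun y hy => ?_) (compIn_mono Set.subset_union_left)
  have := ReachIn.inter_of_closed (A := A) hy hx fun a ha b hb hadj =>
    hb.resolve_right fun hb => hAB a ha b hb hadj
  exact this.mono Set.inter_subset_right

theorem comps_union {A B : Set V} (hAB : ∀ a ∈ A, ∀ b ∈ B, ¬ G.Adj a b) :
    comps G (A ∪ B) = comps G A ∪ comps G B := by
  have hBA : ∀ b ∈ B, ∀ a ∈ A, ¬ G.Adj b a := fun b hb a ha h => hAB a ha b hb h.symm
  have hB : ∀ x ∈ B, compIn G (A ∪ B) x = compIn G B x := fun x hx => by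
    rw [Set.union_comm, compIn_union_left hBA hx]
  ext K
  constructor
  · rintro ⟨x, hx | hx, rfl⟩
    · exact Or.inl ⟨x, hx, compIn_union_left hAB hx⟩
    · exact Or.inr ⟨x, hx, hB x hx⟩
  · rintro (⟨x, hx, rfl⟩ | ⟨x, hx, rfl⟩)
    · exact ⟨x, Or.inl hx, (compIn_union_left hAB hx).symm⟩
    · exact ⟨x, Or.inr hx, (hB x hx).symm⟩

theorem disjoint_comps {A B : Set V} (hAB : Disjoint A B) :
    Disjoint (comps G A) (comps G B) := by
  rw [Set.disjoint_left]
  rintro _ ⟨x, hx, rfl⟩ ⟨y, hy, h⟩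
  exact Set.disjoint_left.1 hAB hx (compIn_subset (h ▸ mem_compIn_self hx))

theorem reachIn_compl_compIn {c k x : V} (h : ReachIn G Set.univ x c)
    (hx : x ∉ compIn G (Set.univ \ {c}) k) : ReachIn G (compIn G (Set.univ \ {c}) k)ᶜ x c := by
  obtain ⟨p, -⟩ := h
  induction p with
  | nil => exact .refl hx
  | @cons u v c huv p ih =>
    by_cases huc : u = c
    · subst huc
      exact .refl hx
    · have hv : v ∉ compIn G (Set.univ \ {c}) k := fun hv =>
        hx (mem_compIn_of_adj hv ⟨Set.mem_univ u, huc⟩ huv.symm)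
      exact (ReachIn.of_adj hx hv huv).trans (ih hv)

end Reach

namespace IsSearchTree

variable {G : SimpleGraph V} {s : Set V} {r : V} {ts : List (RTree V)} {t T : RTree V}

theorem vertSet_eq (h : IsSearchTree G s T) : T.vertSet = s := by
  cases h with | node _ h _ _ => exact h

theorem root_mem (h : IsSearchTree G s T) : T.root ∈ s := by
  cases h with | node h _ _ _ => exact h

theorem child (h : IsSearchTree G s (.node r ts)) (ht : t ∈ ts) :
    IsSearchTree G (compIn G (s \ {r}) t.root) t := by
  cases h with | node _ _ h _ => exact h t ht

theorem root_child_mem (h : IsSearchTree G s (.node r ts)) (ht : t ∈ ts) :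
    t.root ∈ s \ {r} :=
  ReachIn.left_mem (h.child ht).root_mem

theorem root_notMem_child (h : IsSearchTree G s (.node r ts)) (ht : t ∈ ts) :
    r ∉ t.vertSet := by
  rw [(h.child ht).vertSet_eq]
  exact fun hr => (compIn_subset hr).2 rfl

theorem pairwise_disjoint (h : IsSearchTree G s (.node r ts)) :
    ts.Pairwise fun t₁ t₂ => Disjoint t₁.vertSet t₂.vertSet := by
  cases h with
  | node _ _ h h' =>
    refine h'.imp_of_mem fun {a b} ha hb hab => ?_
    rw [(h a ha).vertSet_eq, (h b hb).vertSet_eq, Set.disjoint_left]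
    intro x hx hx'
    exact hab ((compIn_eq_of_mem hx).symm.trans (compIn_eq_of_mem hx'))

theorem eq_of_mem_children (h : IsSearchTree G s (.node r ts)) {t₁ t₂ : RTree V} (h₁ : t₁ ∈ ts)
    (h₂ : t₂ ∈ ts) {v : V} (hv₁ : v ∈ t₁.vertSet) (hv₂ : v ∈ t₂.vertSet) : t₁ = t₂ := by
  by_contra hne
  have : Std.Symm fun t₁ t₂ : RTree V => Disjoint t₁.vertSet t₂.vertSet := ⟨fun _ _ h => h.symm⟩
  exact Set.disjoint_left.1 (h.pairwise_disjoint.forall h₁ h₂ hne) hv₁ hv₂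

theorem pathSet_subset (h : IsSearchTree G s T) (v : V) : T.pathSet v ⊆ T.vertSet := by
  induction h generalizing v with
  | @node s r ts _ _ _ _ ih =>
    rintro x ⟨p, hp, rfl, hx⟩
    rcases RTree.mem_pathsFrom_node.1 hp with rfl | ⟨t, ht, q, hq, rfl⟩
    · rw [RTree.vertSet_node]
      exact Or.inl (by simpa using hx)
    · rcases List.mem_cons.1 hx with rfl | hx
      · rw [RTree.vertSet_node]
        exact Or.inl rfl
      · exact RTree.vertSet_subset_node ht (ih t ht q.1 ⟨q, hq, rfl, hx⟩)

theorem depth_root (h : IsSearchTree G s (.node r ts)) : (RTree.node r ts).depth r = 1 := by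
  have : (RTree.node r ts).pathSet r = {r} := by
    ext x
    constructor
    · rintro ⟨p, hp, hpr, hx⟩
      rcases RTree.mem_pathsFrom_node.1 hp with rfl | ⟨t, ht, q, hq, rfl⟩
      · simpa using hx
      · exact absurd ⟨q, hq, hpr⟩ (h.root_notMem_child ht)
    · rintro rfl
      exact ⟨_, RTree.mem_pathsFrom_node.2 (Or.inl rfl), rfl, by simp⟩
  rw [RTree.depth, this, Set.ncard_singleton]

theorem sum_children (h : IsSearchTree G s (.node r ts)) (g : Set V → ℝ) :
    (ts.map fun t => g t.vertSet).sum = ∑ᶠ H ∈ comps G (s \ {r}), g H := by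
  classical
  have hcomps : comps G (s \ {r}) = ((ts.map RTree.vertSet).toFinset : Set (Set V)) := by
    ext K
    simp only [List.coe_toFinset, List.mem_map, Set.mem_ofPred_eq]
    constructor
    · rintro ⟨x, hx, rfl⟩
      have hxs : x ∈ (RTree.node r ts).vertSet := h.vertSet_eq ▸ hx.1
      rw [RTree.vertSet_node] at hxs
      obtain ⟨t, ht, hxt⟩ : ∃ t ∈ ts, x ∈ t.vertSet := by
        simpa using hxs.resolve_left hx.2
      refine ⟨t, ht, ?_⟩
      rw [(h.child ht).vertSet_eq] at hxt ⊢
      exact (compIn_eq_of_mem hxt).symm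
    · rintro ⟨t, ht, rfl⟩
      exact ⟨t.root, h.root_child_mem ht, (h.child ht).vertSet_eq⟩
  have hnodup : (ts.map RTree.vertSet).Nodup := by
    rw [List.nodup_iff_pairwise_ne, List.pairwise_map]
    refine h.pairwise_disjoint.imp_of_mem fun {a b} ha hb hab heq => ?_
    have hra : a.root ∈ a.vertSet := (h.child ha).vertSet_eq ▸ (h.child ha).root_mem
    exact Set.disjoint_left.1 hab hra (heq ▸ hra)
  rw [hcomps, finsum_mem_coe_finset, List.sum_toFinset _ hnodup, List.map_map]
  rfl

theorem depth_child [Finite V] (h : IsSearchTree G s (.node r ts)) (ht : t ∈ ts) {v : V}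
    (hv : v ∈ t.vertSet) : (RTree.node r ts).depth v = t.depth v + 1 := by
  have : (RTree.node r ts).pathSet v = insert r (t.pathSet v) := by
    ext x
    constructor
    · rintro ⟨p, hp, rfl, hx⟩
      rcases RTree.mem_pathsFrom_node.1 hp with rfl | ⟨t', ht', q, hq, rfl⟩
      · exact Or.inl (by simpa using hx)
      · obtain rfl := h.eq_of_mem_children ht ht' hv ⟨q, hq, rfl⟩
        rcases List.mem_cons.1 hx with rfl | hx
        · exact Or.inl rfl
        · exact Or.inr ⟨q, hq, rfl, hx⟩
    · rintro (rfl | ⟨q, hq, rfl, hx⟩)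
      · obtain ⟨q, hq, rfl⟩ := hv
        exact ⟨_, RTree.mem_pathsFrom_node.2 (Or.inr ⟨t, ht, q, hq, rfl⟩), rfl, by simp⟩
      · exact ⟨_, RTree.mem_pathsFrom_node.2 (Or.inr ⟨t, ht, q, hq, rfl⟩), rfl, by simp [hx]⟩
  rw [RTree.depth, this, Set.ncard_insert_of_notMem
    (fun hr => h.root_notMem_child ht ((h.child ht).pathSet_subset v hr)), RTree.depth]

end IsSearchTree

theorem finsum_mem_biUnion_list {ι : Type*} [Finite V] (S : ι → Set V) (f : V → ℝ)
    (l : List ι) (hl : l.Pairwise fun a b => Disjoint (S a) (S b)) :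
    ∑ᶠ v ∈ ⋃ a ∈ l, S a, f v = (l.map fun a => ∑ᶠ v ∈ S a, f v).sum := by
  induction l with
  | nil => simp
  | cons a l ih =>
    rw [List.pairwise_cons] at hl
    have hU : (⋃ b ∈ a :: l, S b) = S a ∪ ⋃ b ∈ l, S b := by
      ext v
      simp
    have hdisj : Disjoint (S a) (⋃ b ∈ l, S b) := by
      simpa only [Set.disjoint_iUnion_right] using hl.1
    rw [hU, finsum_mem_union hdisj (Set.toFinite _) (Set.toFinite _), ih hl.2, List.map_cons,
      List.sum_cons]

namespace IsSearchTree

variable [Finite V] {G : SimpleGraph V} {s : Set V} {r : V} {ts : List (RTree V)} {T : RTree V}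

theorem finsum_vertSet (h : IsSearchTree G s (.node r ts)) (f : V → ℝ) :
    ∑ᶠ v ∈ s, f v = f r + (ts.map fun t => ∑ᶠ v ∈ t.vertSet, f v).sum := by
  rw [← h.vertSet_eq, RTree.vertSet_node, finsum_mem_insert _ _ (Set.toFinite _),
    finsum_mem_biUnion_list _ _ _ h.pairwise_disjoint]
  simp only [Set.mem_iUnion, not_exists]
  exact fun t ht => h.root_notMem_child ht

theorem cost_node (h : IsSearchTree G s (.node r ts)) (w : V → ℝ) :
    cost w (.node r ts) = wsum w s + (ts.map (cost w)).sum := by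
  have key : ∀ t ∈ ts, ∑ᶠ v ∈ t.vertSet, w v * ((RTree.node r ts).depth v : ℝ) =
      ∑ᶠ v ∈ t.vertSet, w v + cost w t := fun t ht => by
    rw [cost, ← finsum_mem_add_distrib (Set.toFinite _)]
    refine finsum_mem_congr rfl fun v hv => ?_
    rw [h.depth_child ht hv]
    push_cast
    ring
  rw [cost, h.vertSet_eq, h.finsum_vertSet, h.depth_root, List.map_congr_left key,
    List.sum_map_add, wsum, h.finsum_vertSet]
  simp only [Nat.cast_one, mul_one]
  ring

end IsSearchTree

/-- Joining search trees on the components of `s \ {r}` below `r` gives a search tree on `s`. -/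
theorem exists_isSearchTree_node [Finite V] {G : SimpleGraph V} {s : Set V} {r : V} (hr : r ∈ s)
    (f : Set V → RTree V) (hf : ∀ H ∈ comps G (s \ {r}), IsSearchTree G H (f H)) :
    ∃ ts : List (RTree V), (∀ t ∈ ts, ∃ H ∈ comps G (s \ {r}), t = f H) ∧
      IsSearchTree G s (.node r ts) := by
  classical
  have hfin : (comps G (s \ {r})).Finite := Set.toFinite _
  have hroot : ∀ H ∈ comps G (s \ {r}), compIn G (s \ {r}) (f H).root = H := by
    intro H hH
    have := (hf H hH).root_mem
    obtain ⟨x, hx, rfl⟩ := hH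
    exact compIn_eq_of_mem this
  have hmem : ∀ t, t ∈ hfin.toFinset.toList.map f ↔ ∃ H ∈ comps G (s \ {r}), f H = t := by
    simp
  refine ⟨hfin.toFinset.toList.map f, fun t ht => ?_, .node hr ?_ ?_ ?_⟩
  · obtain ⟨H, hH, rfl⟩ := (hmem t).1 ht
    exact ⟨H, hH, rfl⟩
  · rw [RTree.vertSet_node]
    ext v
    simp only [Set.mem_insert_iff, Set.mem_iUnion, hmem, exists_prop]
    constructor
    · rintro (rfl | ⟨_, ⟨H, hH, rfl⟩, hv⟩)
      · exact hr
      · rw [(hf H hH).vertSet_eq] at hv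
        obtain ⟨x, hx, rfl⟩ := hH
        exact (compIn_subset hv).1
    · intro hv
      by_cases hvr : v = r
      · exact Or.inl hvr
      · have hv' : v ∈ s \ {r} := ⟨hv, hvr⟩
        have hH : compIn G (s \ {r}) v ∈ comps G (s \ {r}) := ⟨v, hv', rfl⟩
        refine Or.inr ⟨_, ⟨_, hH, rfl⟩, ?_⟩
        rw [(hf _ hH).vertSet_eq]
        exact mem_compIn_self hv'
  · intro t ht
    obtain ⟨H, hH, rfl⟩ := (hmem t).1 ht
    rw [hroot H hH]
    exact hf H hH
  · rw [List.pairwise_map]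
    refine (List.nodup_iff_pairwise_ne.1 (Finset.nodup_toList _)).imp_of_mem
      fun {a b} ha hb hab => ?_
    rwa [hroot a (by simpa using ha), hroot b (by simpa using hb)]

theorem exists_isSearchTree [Finite V] (G : SimpleGraph V) {s : Set V} (hs : s.Nonempty) :
    ∃ T, IsSearchTree G s T := by
  induction hn : s.ncard using Nat.strong_induction_on generalizing s with
  | _ n ih =>
    obtain ⟨r, hr⟩ := hs
    have hcomp : ∀ H ∈ comps G (s \ {r}), ∃ T, IsSearchTree G H T := by
      rintro _ ⟨x, hx, rfl⟩
      refine ih _ ?_ ⟨x, mem_compIn_self hx⟩ rfl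
      rw [← hn]
      exact (Set.ncard_le_ncard compIn_subset).trans_lt (Set.ncard_sdiff_singleton_lt_of_mem hr)
    have : Nonempty (RTree V) := ⟨.node r []⟩
    choose! f hf using hcomp
    obtain ⟨ts, -, h⟩ := exists_isSearchTree_node hr f hf
    exact ⟨_, h⟩

section Opt

variable [Finite V] {G : SimpleGraph V} {w : V → ℝ} {s : Set V}

theorem finite_range_cost (w : V → ℝ) : (Set.range (cost w)).Finite := by
  have hfin : (Set.range fun p : Set V × (V → Fin (Nat.card V + 1)) =>
      ∑ᶠ v ∈ p.1, w v * ((p.2 v : ℕ) : ℝ)).Finite := Set.finite_range _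
  refine hfin.subset ?_
  rintro _ ⟨T, rfl⟩
  exact ⟨(T.vertSet, fun v => ⟨T.depth v, Nat.lt_succ_of_le (Set.ncard_le_card _)⟩), rfl⟩

theorem OPT_le_cost {T : RTree V} (h : IsSearchTree G s T) : OPT G w s ≤ cost w T :=
  csInf_le ((finite_range_cost w).subset (Set.image_subset_range _ _)).bddBelow ⟨T, h, rfl⟩

theorem exists_cost_eq_OPT (hs : s.Nonempty) : ∃ T, IsSearchTree G s T ∧ cost w T = OPT G w s := by
  obtain ⟨T, hT⟩ := exists_isSearchTree G hs
  exact Set.Nonempty.csInf_mem (s := cost w '' {T | IsSearchTree G s T}) ⟨_, T, hT, rfl⟩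
    ((finite_range_cost w).subset (Set.image_subset_range _ _))

theorem OPT_le_of_mem {r : V} (hr : r ∈ s) :
    OPT G w s ≤ wsum w s + ∑ᶠ H ∈ comps G (s \ {r}), OPT G w H := by
  have hcomp : ∀ H ∈ comps G (s \ {r}), ∃ T, IsSearchTree G H T ∧ cost w T = OPT G w H := by
    rintro _ ⟨x, hx, rfl⟩
    exact exists_cost_eq_OPT ⟨x, mem_compIn_self hx⟩
  have : Nonempty (RTree V) := ⟨.node r []⟩
  choose! f hf using hcomp
  obtain ⟨ts, hts, h⟩ := exists_isSearchTree_node hr f fun H hH => (hf H hH).1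
  refine (OPT_le_cost h).trans_eq ?_
  rw [h.cost_node, ← h.sum_children]
  congr 2
  refine List.map_congr_left fun t ht => ?_
  obtain ⟨H, hH, rfl⟩ := hts t ht
  rw [(hf H hH).2, (hf H hH).1.vertSet_eq]

theorem exists_mem_le_OPT (hs : s.Nonempty) :
    ∃ r ∈ s, wsum w s + ∑ᶠ H ∈ comps G (s \ {r}), OPT G w H ≤ OPT G w s := by
  obtain ⟨⟨r, ts⟩, h, hcost⟩ := exists_cost_eq_OPT (G := G) (w := w) hs
  refine ⟨r, h.root_mem, ?_⟩
  rw [← hcost, h.cost_node, ← h.sum_children]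
  gcongr
  refine List.sum_le_sum fun t ht => OPT_le_cost ?_
  have := h.child ht
  rwa [this.vertSet_eq]

/-- Deleting a vertex only affects the summand of its own component. -/
theorem finsum_comps_add (w : V → ℝ) {x : V} (hx : x ∈ s) :
    ∑ᶠ H ∈ comps G s, OPT G w H + ∑ᶠ H ∈ comps G (compIn G s x \ {x}), OPT G w H =
      OPT G w (compIn G s x) + ∑ᶠ H ∈ comps G (s \ {x}), OPT G w H := by
  set K := compIn G s x
  have hxK : x ∈ K := mem_compIn_self hx
  have hsep : ∀ a ∈ K, ∀ b ∈ s \ K, ¬ G.Adj a b := fun a ha b hb h =>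
    hb.2 (mem_compIn_of_adj ha hb.1 h)
  have hs : s = K ∪ s \ K := (Set.union_sdiff_cancel compIn_subset).symm
  have hsx : s \ {x} = K \ {x} ∪ s \ K := by
    ext v
    have := @compIn_subset _ G s x v
    simp only [Set.mem_sdiff, Set.mem_union, Set.mem_singleton_iff]
    grind
  have e₁ : comps G s = comps G K ∪ comps G (s \ K) := by
    conv_lhs => rw [hs]
    exact comps_union hsep
  have e₂ : comps G (s \ {x}) = comps G (K \ {x}) ∪ comps G (s \ K) := by
    rw [hsx]
    exact comps_union fun a ha => hsep a ha.1
  rw [e₁, e₂, finsum_mem_union (disjoint_comps Set.disjoint_sdiff_right) (Set.toFinite _)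
    (Set.toFinite _), finsum_mem_union (disjoint_comps
    (Set.disjoint_sdiff_right.mono_left Set.sdiff_subset)) (Set.toFinite _) (Set.toFinite _),
    comps_eq_singleton hxK (compIn_compIn hx), finsum_mem_singleton]
  ring

theorem OPT_sub_step {c : V} (hc : c ∈ s) :
    wsum w s + ∑ᶠ H ∈ comps G (s \ {c}), OPT G w H ≤ OPT G w s ∨
    ∃ r ∈ s \ {c}, wsum w s - wsum w (compIn G (s \ {c}) r) +
      (OPT G w (compIn G (s \ {r}) c) -
        ∑ᶠ H ∈ comps G (compIn G (s \ {r}) c \ {c}), OPT G w H) ≤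
      OPT G w s - ∑ᶠ H ∈ comps G (s \ {c}), OPT G w H := by
  obtain ⟨r, hr, hle⟩ := exists_mem_le_OPT (G := G) (w := w) ⟨c, hc⟩
  by_cases hrc : r = c
  · exact Or.inl (hrc ▸ hle)
  · have hr' : r ∈ s \ {c} := ⟨hr, hrc⟩
    have hc' : c ∈ s \ {r} := ⟨hc, Ne.symm hrc⟩
    refine Or.inr ⟨r, hr', ?_⟩
    have h₁ := finsum_comps_add (G := G) w hr'
    have h₂ := finsum_comps_add (G := G) w hc'
    have h₃ := OPT_le_of_mem (G := G) (w := w) (mem_compIn_self (G := G) hr')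
    rw [sdiff_right_comm] at h₂
    linarith

theorem wsum_mono (hw : ∀ x, 0 ≤ w x) {t : Set V} (h : s ⊆ t) : wsum w s ≤ wsum w t := by
  have := finsum_mem_union (f := w) (Set.disjoint_sdiff_right (s := s) (t := t))
    (Set.toFinite _) (Set.toFinite _)
  rw [Set.union_sdiff_cancel h] at this
  rw [wsum, wsum, this]
  exact le_add_of_nonneg_right (finsum_nonneg fun v => finsum_nonneg fun _ => hw v)

theorem wsum_sub_le (hw : ∀ x, 0 ≤ w x) {K : Set V} (h : Kᶜ ⊆ s) :
    wsum w Set.univ - wsum w K ≤ wsum w s := by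
  have h₁ : wsum w (K ∪ Kᶜ) = wsum w K + wsum w Kᶜ :=
    finsum_mem_union disjoint_compl_right (Set.toFinite _) (Set.toFinite _)
  rw [Set.union_compl_self] at h₁
  linarith [wsum_mono hw h]

theorem ncard_compIn_sdiff_lt {r : V} (hr : r ∈ s) (c : V) :
    (compIn G (s \ {r}) c).ncard < s.ncard :=
  (Set.ncard_le_ncard compIn_subset).trans_lt (Set.ncard_sdiff_singleton_lt_of_mem hr)

theorem le_OPT_sub (hw : ∀ x, 0 ≤ w x) {c : V} (hc : c ∈ s) :
    w c ≤ OPT G w s - ∑ᶠ H ∈ comps G (s \ {c}), OPT G w H := by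
  induction hn : s.ncard using Nat.strong_induction_on generalizing s with
  | _ n ih =>
    have hcs : w c ≤ wsum w s :=
      (finsum_mem_singleton (f := w) (a := c)).ge.trans <| wsum_mono hw (Set.singleton_subset_iff.2 hc)
    rcases OPT_sub_step (G := G) (w := w) hc with h | ⟨r, hr, h⟩
    · linarith
    · have hc' : c ∈ s \ {r} := ⟨hc, fun h => hr.2 h.symm⟩
      have := ih _ (hn ▸ ncard_compIn_sdiff_lt hr.1 c) (mem_compIn_self (G := G) hc') rfl
      have : wsum w (compIn G (s \ {c}) r) ≤ wsum w s :=
        wsum_mono hw (compIn_subset.trans Set.sdiff_subset)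
      linarith

/-- If `s` contains everything outside one component `K` of the complement of `c` and all those
components have weight at most `b`, then splitting at `c` saves the weight outside `K` up to `b`. -/
theorem le_OPT_sub_of_compl_subset (hw : ∀ x, 0 ≤ w x) {c k : V} {b : ℝ}
    (hG : ∀ x, ReachIn G Set.univ x c)
    (hb : ∀ x ∈ Set.univ \ {c}, wsum w (compIn G (Set.univ \ {c}) x) ≤ b)
    (hs : (compIn G (Set.univ \ {c}) k)ᶜ ⊆ s) :
    wsum w Set.univ - wsum w (compIn G (Set.univ \ {c}) k) - b + min b (w c) ≤
      OPT G w s - ∑ᶠ H ∈ comps G (s \ {c}), OPT G w H := by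
  induction hn : s.ncard using Nat.strong_induction_on generalizing s with
  | _ n ih =>
    have hcK : c ∉ compIn G (Set.univ \ {c}) k := fun h => (compIn_subset h).2 rfl
    have hle := wsum_sub_le hw hs
    rcases OPT_sub_step (G := G) (w := w) (hs hcK) with h | ⟨r, hr, h⟩
    · linarith [min_le_left b (w c)]
    · have hcr : c ∈ s \ {r} := ⟨hs hcK, fun h => hr.2 h.symm⟩
      by_cases hrK : r ∈ compIn G (Set.univ \ {c}) k
      · have hsub : (compIn G (Set.univ \ {c}) k)ᶜ ⊆ compIn G (s \ {r}) c := fun x hx =>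
          ReachIn.symm ((reachIn_compl_compIn (hG x) hx).mono fun y hy =>
            ⟨hs hy, fun hyr => hy (Set.mem_singleton_iff.1 hyr ▸ hrK)⟩)
        have h₁ := ih _ (hn ▸ ncard_compIn_sdiff_lt hr.1 c) hsub rfl
        have h₂ : wsum w (compIn G (s \ {c}) r) ≤ wsum w s :=
          wsum_mono hw (compIn_subset.trans Set.sdiff_subset)
        linarith
      · have h₁ := le_OPT_sub (G := G) hw (mem_compIn_self (G := G) hcr)
        have h₂ : wsum w (compIn G (s \ {c}) r) ≤ wsum w (compIn G (Set.univ \ {c}) r) :=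
          wsum_mono hw (compIn_mono (Set.sdiff_subset_sdiff_left (Set.subset_univ _)))
        linarith [hb r ⟨Set.mem_univ _, hr.2⟩, min_le_right b (w c)]

end Opt

theorem opt_lower_bound_alpha_centroid_strong {V : Type} [Fintype V]
    (G : SimpleGraph V) (hG : G.IsTree) (w : V → ℝ) (hw : ∀ x, 0 ≤ w x)
    (α : ℝ) (hα0 : 1 / 3 ≤ α) (hα1 : α ≤ 1 / 2)
    (c : V) (hc : IsAlphaCentroid G w α Set.univ c) :
    OPT G w Set.univ ≥
      (2 - 3 * α) * wsum w Set.univ + (3 * α - 1) * w c +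
        ∑ᶠ H ∈ comps G (Set.univ \ {c}), OPT G w H := by
  have hreach : ∀ x, ReachIn G Set.univ x c := fun x =>
    (hG.connected.preconnected x c).elim fun p => ⟨p, fun _ _ => Set.mem_univ _⟩
  have hcm : w c ≤ wsum w Set.univ :=
    (finsum_mem_singleton (f := w) (a := c)).ge.trans <| wsum_mono hw (Set.subset_univ {c})
  rcases OPT_sub_step (G := G) (w := w) (Set.mem_univ c) with h | ⟨r, hr, h⟩
  · nlinarith
  · have hsub : (compIn G (Set.univ \ {c}) r)ᶜ ⊆ compIn G (Set.univ \ {r}) c := fun x hx =>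
      ReachIn.symm ((reachIn_compl_compIn (hreach x) hx).mono <| Set.compl_subset_comm.1 <| by
        rw [← Set.compl_eq_univ_sdiff, compl_compl, Set.singleton_subset_iff]
        exact mem_compIn_self hr)
    have h₁ := le_OPT_sub_of_compl_subset hw hreach hc.2 hsub
    have h₂ := hc.2 r hr
    have h₃ : (3 * α - 1) * w c ≤ min (α * wsum w Set.univ) (w c) :=
      le_min (by nlinarith [hw c]) (by nlinarith [hw c])
    linarith
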